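/- For all integers t ≥ 5 and k > t, the optimal redundancy of function-correcting codes for the Hamming weight function satisfies r_wt(k,t) ≥ 4t − (4/3)·√(6t+2) + 2 (an inequality of real numbers, with the natural number r_wt(k,t) coerced to ℝ). -/

import Mathlib

/-- The optimal redundancy `r_f(k,t)`: the least `r` for which there exists a
function-correcting code `p : 𝔽₂^k → 𝔽₂^r` for `f` correcting `t` errors. -/
noncomputable def optRedundancy {α : Type*} (k t : ℕ) (f : (Fin k → ZMod 2) → α) : ℕ :=
  sInf {r : ℕ | ∃ p : (Fin k → ZMod 2) → (Fin r → ZMod 2),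
    ∀ u v, f u ≠ f v → 2 * t + 1 ≤ hammingDist u v + hammingDist (p u) (p v)}

theorem fcc_set_nonempty (k t : ℕ) :
    ({r : ℕ | ∃ p : (Fin k → ZMod 2) → (Fin r → ZMod 2),
    ∀ u v, hammingNorm u ≠ hammingNorm v →
      2 * t + 1 ≤ hammingDist u v + hammingDist (p u) (p v)}).Nonempty := by
  refine ⟨k * (2 * t + 1), fun u i => u (finProdFinEquiv.symm i).1, ?_⟩
  intro u v h
  have hne : u ≠ v := fun e => h (by rw [e])
  obtain ⟨j, hj⟩ := Function.ne_iff.mp hne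
  refine le_trans ?_ (Nat.le_add_left _ _)
  change _ ≤ (Finset.univ.filter fun i : Fin (k * (2 * t + 1)) =>
    u (finProdFinEquiv.symm i).1 ≠ v (finProdFinEquiv.symm i).1).card
  have h1 : ((Finset.univ : Finset (Fin (2 * t + 1))).image
      (fun a => finProdFinEquiv (j, a))).card = 2 * t + 1 := by
    rw [Finset.card_image_of_injective]
    · simp
    · intro a b hab
      simpa using hab
  refine h1.symm.le.trans (Finset.card_le_card ?_)
  intro x hx
  obtain ⟨a, -, rfl⟩ := Finset.mem_image.mp hx
  refine Finset.mem_filter.mpr ⟨Finset.mem_univ _, ?_⟩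
  rw [Equiv.symm_apply_apply]
  exact hj

def stepVec (k i : ℕ) : Fin k → ZMod 2 := fun x => if (x : ℕ) < i then 1 else 0

theorem norm_stepVec (k i : ℕ) (h : i ≤ k) : hammingNorm (stepVec k i) = i := by
  have : hammingNorm (stepVec k i) = (Finset.univ.filter fun x : Fin k => (x : ℕ) < i).card := by
    unfold hammingNorm
    congr 1
    ext x
    simp [stepVec]
  rw [this, Fin.card_filter_val_lt, min_eq_right h]

theorem dist_stepVec (k i j : ℕ) (h : i ≤ j) :
    hammingDist (stepVec k i) (stepVec k j) ≤ j - i := by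
  change (Finset.univ.filter fun x : Fin k => stepVec k i x ≠ stepVec k j x).card ≤ _
  rw [← Nat.card_Ico, ← Finset.card_map Fin.valEmbedding]
  apply Finset.card_le_card
  intro x hx
  obtain ⟨a, ha, rfl⟩ := Finset.mem_map.mp hx
  replace ha := (Finset.mem_filter.mp ha).2
  simp only [Fin.valEmbedding_apply, Finset.mem_Ico]
  by_contra hc
  apply ha
  have : (a : ℕ) < i ↔ (a : ℕ) < j := by omega
  simp [stepVec, this]

theorem coord_sum (x : ℕ → ZMod 2) (M : ℕ) :
    ∃ a b : ℕ, a + b = M ∧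
      (∑ j ∈ Finset.range M, if x j = 0 then 1 else 0) = a ∧
      (∑ j ∈ Finset.range M, if x j = 1 then 1 else 0) = b ∧
      (∑ j ∈ Finset.range M, ∑ i ∈ Finset.range j, if x i ≠ x j then 1 else 0) = a * b := by
  induction M with
  | zero => exact ⟨0, 0, by simp⟩
  | succ M ih =>
    obtain ⟨a, b, h, ha, hb, hs⟩ := ih
    simp only [Finset.sum_range_succ, ha, hb, hs]
    have hx : ∀ y : ZMod 2, y = 0 ∨ y = 1 := by decide
    have n0 : ∀ y : ZMod 2, y ≠ 0 ↔ y = 1 := by decide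
    have n1 : ∀ y : ZMod 2, y ≠ 1 ↔ y = 0 := by decide
    rcases hx (x M) with e | e
    · refine ⟨a + 1, b, by omega, by simp [e], by simp [e], ?_⟩
      rw [e]
      simp only [n0, hb]
      ring
    · refine ⟨a, b + 1, by omega, by simp [e], by simp [e], ?_⟩
      rw [e]
      simp only [n1, ha]
      ring

theorem coord_bound (x : ℕ → ZMod 2) (n : ℕ) :
    (∑ j ∈ Finset.range (2 * n + 1), ∑ i ∈ Finset.range j, if x i ≠ x j then 1 else 0)
      ≤ n * (n + 1) := by
  obtain ⟨a, b, h, -, -, hs⟩ := coord_sum x (2 * n + 1)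
  rw [hs]
  rcases Nat.lt_or_ge n a with h1 | h1
  · obtain ⟨c, rfl⟩ := Nat.exists_eq_add_of_lt h1
    have : n = b + c := by omega
    subst this
    nlinarith
  · obtain ⟨c, rfl⟩ := Nat.exists_eq_add_of_le h1
    have : b = a + c + c + 1 := by omega
    subst this
    nlinarith

theorem dist_sum_bound (r : ℕ) (q : ℕ → Fin r → ZMod 2) (n : ℕ) :
    (∑ j ∈ Finset.range (2 * n + 1), ∑ i ∈ Finset.range j, hammingDist (q i) (q j))
      ≤ r * (n * (n + 1)) := by
  have : (∑ j ∈ Finset.range (2 * n + 1), ∑ i ∈ Finset.range j, hammingDist (q i) (q j))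
      = ∑ c : Fin r, ∑ j ∈ Finset.range (2 * n + 1), ∑ i ∈ Finset.range j,
        if q i c ≠ q j c then 1 else 0 := by
    rw [Finset.sum_comm]
    refine Finset.sum_congr rfl fun j _ => ?_
    rw [Finset.sum_comm]
    refine Finset.sum_congr rfl fun i _ => ?_
    unfold hammingDist
    rw [Finset.card_filter]
  rw [this]
  calc _ ≤ ∑ c : Fin r, n * (n + 1) :=
        Finset.sum_le_sum fun c _ => coord_bound (fun i => q i c) n
    _ = _ := by simp

theorem fcc_inner_sum (t j : ℕ) :
    2 * (∑ i ∈ Finset.range j, ((2 * t + 1 : ℤ) - ((j : ℤ) - i))) =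
      2 * j * (2 * t + 1) - j * (j + 1) := by
  have h : ∀ m : ℕ, 2 * (∑ i ∈ Finset.range m, ((2 * t + 1 : ℤ) - ((j : ℤ) - i))) =
      2 * m * (2 * t + 1) - 2 * m * j + m * (m - 1) := by
    intro m
    induction m with
    | zero => simp
    | succ m ih => rw [Finset.sum_range_succ, mul_add, ih]; push_cast; ring
  rw [h]; ring

theorem outer_sum (t M : ℕ) :
    6 * (∑ j ∈ Finset.range M, ∑ i ∈ Finset.range j, ((2 * t + 1 : ℤ) - ((j : ℤ) - i))) =
      3 * M * (M - 1) * (2 * t + 1) - (M + 1) * M * (M - 1) := by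
  induction M with
  | zero => simp
  | succ M ih =>
    rw [Finset.sum_range_succ, mul_add, ih]
    have := fcc_inner_sum t M
    push_cast
    linear_combination 3 * this

theorem plotkin (k t r n : ℕ) (hn : 2 * n ≤ k) (hpos : 0 < n)
    (p : (Fin k → ZMod 2) → (Fin r → ZMod 2))
    (hp : ∀ u v, hammingNorm u ≠ hammingNorm v →
      2 * t + 1 ≤ hammingDist u v + hammingDist (p u) (p v)) :
    (3 * (2 * n + 1) * (2 * t + 1) : ℤ) ≤ 3 * r * (n + 1) + 2 * (n + 1) * (2 * n + 1) := by
  have h1 := dist_sum_bound r (fun i => p (stepVec k i)) n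
  have h2 : (∑ j ∈ Finset.range (2 * n + 1), ∑ i ∈ Finset.range j,
      ((2 * t + 1 : ℤ) - ((j : ℤ) - i))) ≤
      ∑ j ∈ Finset.range (2 * n + 1), ∑ i ∈ Finset.range j,
        (hammingDist (p (stepVec k i)) (p (stepVec k j)) : ℤ) := by
    refine Finset.sum_le_sum fun j hj => Finset.sum_le_sum fun i hi => ?_
    rw [Finset.mem_range] at hi hj
    have a := hp (stepVec k i) (stepVec k j) (by
      rw [norm_stepVec _ _ (by omega), norm_stepVec _ _ (by omega)]; omega)
    have b := dist_stepVec k i j hi.le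
    omega
  have h3 := outer_sum t (2 * n + 1)
  have h1' : (∑ j ∈ Finset.range (2 * n + 1), ∑ i ∈ Finset.range j,
        (hammingDist (p (stepVec k i)) (p (stepVec k j)) : ℤ)) ≤ r * (n * (n + 1)) := by
    exact_mod_cast h1
  have h4 := h2.trans h1'
  push_cast at h3
  have hn' : (0 : ℤ) < 2 * n := by exact_mod_cast (by omega : 0 < 2 * n)
  refine le_of_mul_le_mul_left ?_ hn'
  nlinarith

theorem stmt_6 (k t : ℕ) (ht : 5 ≤ t) (hk : t < k) :
    4 * (t : ℝ) - (4 / 3) * Real.sqrt (6 * (t : ℝ) + 2) + 2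
      ≤ (optRedundancy k t (fun u => hammingNorm u) : ℝ) := by
  obtain ⟨p, hp⟩ := Nat.sInf_mem (fcc_set_nonempty k t)
  change 4 * (t : ℝ) - (4 / 3) * Real.sqrt (6 * (t : ℝ) + 2) + 2
      ≤ ((sInf {r : ℕ | ∃ p : (Fin k → ZMod 2) → (Fin r → ZMod 2),
    ∀ u v, hammingNorm u ≠ hammingNorm v →
      2 * t + 1 ≤ hammingDist u v + hammingDist (p u) (p v)} : ℕ) : ℝ)
  generalize sInf {r : ℕ | ∃ p : (Fin k → ZMod 2) → (Fin r → ZMod 2),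
    ∀ u v, hammingNorm u ≠ hammingNorm v →
      2 * t + 1 ≤ hammingDist u v + hammingDist (p u) (p v)} = r at p hp ⊢
  have htR : (5 : ℝ) ≤ t := by exact_mod_cast ht
  set s := Real.sqrt (6 * (t : ℝ) + 2) with hs
  have hs2 : s ^ 2 = 6 * t + 2 := Real.sq_sqrt (by positivity)
  have hs0 : 0 ≤ s := Real.sqrt_nonneg _
  have hs5 : 5 ≤ s := Real.le_sqrt_of_sq_le (by linarith)
  have hst : s ≤ t + 2 := Real.sqrt_le_iff.mpr ⟨by positivity, by nlinarith⟩
  have f1 := Nat.floor_le (show 0 ≤ (s + 1) / 2 by positivity)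
  have f2 := Nat.lt_floor_add_one ((s + 1) / 2)
  generalize ⌊(s + 1) / 2⌋₊ = m at f1 f2
  have hm : 2 < m + 1 := by
    have : (2 : ℝ) < (m : ℝ) + 1 := by linarith
    exact_mod_cast this
  obtain ⟨n, rfl⟩ : ∃ n, m = n + 1 := ⟨m - 1, by omega⟩
  push_cast at f1 f2
  have hnk : 2 * n ≤ t + 1 := by
    have : (2 * n : ℝ) ≤ t + 1 := by linarith
    exact_mod_cast this
  have key := plotkin k t r n (by omega) (by omega) p hp
  have key' : (3 * (2 * n + 1) * (2 * t + 1) : ℝ)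
      ≤ 3 * r * (n + 1) + 2 * (n + 1) * (2 * n + 1) := by exact_mod_cast key
  have hn1 : (1 : ℝ) ≤ n := by exact_mod_cast (by omega : 1 ≤ n)
  have hd : (2 * ((n : ℝ) + 1) - s) ^ 2 ≤ 1 := by
    rw [sq_le_one_iff_abs_le_one, abs_le]
    constructor <;> linarith
  have hpos : (0 : ℝ) < 3 * (n + 1) := by positivity
  refine le_of_mul_le_mul_left ?_ hpos
  nlinarith
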